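/- Equality of the two subordination formulas for fractional Cauchy problems: Let 1/2 ≤ γ < 1, α = 1/γ, let g_γ(u) = p_γ(u; γ, 1), and let h(u,t) = (t/γ) u^{−1−1/γ} g_γ(t u^{−1/γ}) for u > 0. Then for every t > 0 and every measurable function f: (0,∞) → ℝ such that u ↦ f(u) h(u,t) is Lebesgue integrable on (0,∞), ∫_0^∞ f(u) h(u,t) du = (1/γ) ∫_0^∞ f(u) p_{1/γ}(u; (1/γ)(2γ−1), t) du, and in particular the second integrand is also integrable. -/

import Mathlib

open MeasureTheory Real Set

/-- Zolotarev's parametrization of the stable density: the real-valued inverse Fourier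
integral `p_α(x; η, b) = (1/(2π)) ∫ e^{-iλx} exp(-b|λ|^α e^{-iπη·sgn(λ)/2}) dλ`. -/
noncomputable def zolDensity (α η b x : ℝ) : ℝ :=
  (1 / (2 * Real.pi)) *
    (∫ l : ℝ, Complex.exp (-Complex.I * (l : ℂ) * (x : ℂ)) *
        Complex.exp (-(b : ℂ) * ((|l| ^ α : ℝ) : ℂ) *
          Complex.exp (-Complex.I * (Real.pi : ℂ) * (η : ℂ) * ((Real.sign l : ℝ) : ℂ) / 2))).re

/-- The entire function `exp(-u e^w + t e^{αw})`. -/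
noncomputable def stE (α u t : ℝ) (w : ℂ) : ℂ :=
  Complex.exp (-(u : ℂ) * Complex.exp w + (t : ℂ) * Complex.exp ((α : ℂ) * w))

lemma exp_line_re (α x φ : ℝ) :
    (Complex.exp ((α : ℂ) * ((x : ℂ) + (φ : ℂ) * Complex.I))).re
      = Real.exp (α * x) * Real.cos (α * φ) := by
  rw [Complex.exp_re]; simp

lemma exp_line_norm (α x φ : ℝ) :
    ‖Complex.exp ((α : ℂ) * ((x : ℂ) + (φ : ℂ) * Complex.I))‖ = Real.exp (α * x) := by
  rw [Complex.norm_exp]; simp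

lemma stE_norm (α u t x φ : ℝ) :
    ‖stE α u t ((x : ℂ) + (φ : ℂ) * Complex.I)‖
      = Real.exp (-u * (Real.exp x * Real.cos φ) + t * (Real.exp (α * x) * Real.cos (α * φ))) := by
  have h1 := exp_line_re 1 x φ
  have h2 := exp_line_re α x φ
  simp only [Complex.ofReal_one, one_mul] at h1
  rw [stE, Complex.norm_exp, Complex.add_re, ← Complex.ofReal_neg, Complex.re_ofReal_mul,
    Complex.re_ofReal_mul, h1, h2]

lemma stE_bound (α γ u t : ℝ) (hγ1 : 1 / 2 ≤ γ) (hγ2 : γ < 1) (hα : α = 1 / γ)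
    (hu : 0 < u) (ht : 0 < t) :
    ∃ c > 0, ∀ φ ∈ Icc (π * γ / 2) (π / 2), ∀ x : ℝ,
      ‖stE α u t ((x : ℂ) + (φ : ℂ) * Complex.I)‖ ≤ Real.exp (c - c * Real.exp x) := by
  have hγ0 : 0 < γ := by linarith
  have hαγ : α * γ = 1 := by rw [hα]; field_simp
  have hα1 : 1 < α := by rw [hα]; exact one_lt_one_div hγ0 hγ2
  have hα2 : α ≤ 2 := by rw [hα, div_le_iff₀ hγ0]; linarith
  have hπ := Real.pi_pos
  have hc1 : ∀ φ ∈ Icc (π * γ / 2) (π / 2), 0 ≤ Real.cos φ := by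
    intro φ hφ
    apply Real.cos_nonneg_of_mem_Icc
    refine ⟨?_, hφ.2⟩
    have : 0 < π * γ := by positivity
    linarith [hφ.1]
  have hr : ∀ φ ∈ Icc (π * γ / 2) (π / 2), π / 2 ≤ α * φ ∧ α * φ ≤ π := by
    intro φ hφ
    have hα0 : 0 ≤ α := by linarith
    have h1 := mul_le_mul_of_nonneg_left hφ.1 hα0
    have h2 := mul_le_mul_of_nonneg_left hφ.2 hα0
    have h3 : α * (π * γ / 2) = π / 2 := by linear_combination (π / 2) * hαγ
    constructor
    · linarith
    · nlinarith
  have hc2 : ∀ φ ∈ Icc (π * γ / 2) (π / 2), Real.cos (α * φ) ≤ 0 := by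
    intro φ hφ
    exact Real.cos_nonpos_of_pi_div_two_le_of_le (hr φ hφ).1 (by linarith [(hr φ hφ).2])
  have hcpt : IsCompact (Icc (π * γ / 2) (π / 2)) := isCompact_Icc
  have hne : (Icc (π * γ / 2) (π / 2)).Nonempty := nonempty_Icc.2 (by nlinarith)
  obtain ⟨φ₀, hφ₀, hmin⟩ := hcpt.exists_isMinOn hne
    (f := fun φ => u * Real.cos φ - t * Real.cos (α * φ)) (by fun_prop)
  refine ⟨u * Real.cos φ₀ - t * Real.cos (α * φ₀), ?_, ?_⟩
  · have a1 := hc1 _ hφ₀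
    have a2 := hc2 _ hφ₀
    rcases hφ₀.2.lt_or_eq with h | h
    · have : 0 < Real.cos φ₀ := by
        apply Real.cos_pos_of_mem_Ioo
        refine ⟨?_, h⟩
        have : 0 < π * γ := by positivity
        linarith [hφ₀.1]
      have := mul_pos hu this
      nlinarith
    · have : Real.cos (α * φ₀) < 0 := by
        apply Real.cos_neg_of_pi_div_two_lt_of_lt
        · rw [h]; nlinarith
        · linarith [(hr _ hφ₀).2]
      have := mul_neg_of_pos_of_neg ht this
      nlinarith
  · intro φ hφ x
    rw [stE_norm]
    apply Real.exp_le_exp.2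
    have hm : u * Real.cos φ₀ - t * Real.cos (α * φ₀) ≤ u * Real.cos φ - t * Real.cos (α * φ) :=
      hmin hφ
    set c := u * Real.cos φ₀ - t * Real.cos (α * φ₀)
    have a1 := mul_nonneg hu.le (hc1 _ hφ)
    have a2 := mul_nonneg ht.le (neg_nonneg.2 (hc2 _ hφ))
    have hc : 0 ≤ c := by
      have b1 := mul_nonneg hu.le (hc1 _ hφ₀)
      have b2 := mul_nonneg ht.le (neg_nonneg.2 (hc2 _ hφ₀))
      show 0 ≤ u * Real.cos φ₀ - t * Real.cos (α * φ₀)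
      linarith
    rcases le_total 0 x with hx | hx
    · have e1 : Real.exp x ≤ Real.exp (α * x) := Real.exp_le_exp.2 (by nlinarith)
      have e2 := mul_le_mul_of_nonneg_right e1 a2
      have e3 := mul_le_mul_of_nonneg_right hm (Real.exp_pos x).le
      nlinarith
    · have e1 : Real.exp x ≤ 1 := Real.exp_le_one_iff.2 hx
      have e2 := mul_nonneg (Real.exp_pos x).le a1
      have e3 := mul_nonneg (Real.exp_pos (α * x)).le a2
      nlinarith

lemma range_affexp (β d : ℝ) (hβ : 0 < β) :
    (fun x : ℝ => Real.exp (β * x + d)) '' univ = Ioi 0 := by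
  ext y
  simp only [image_univ, mem_range, mem_Ioi]
  constructor
  · rintro ⟨x, rfl⟩; positivity
  · intro hy
    refine ⟨(Real.log y - d) / β, ?_⟩
    rw [mul_div_cancel₀ _ hβ.ne']
    simp [Real.exp_log hy]

lemma inj_affexp (β d : ℝ) (hβ : 0 < β) :
    InjOn (fun x : ℝ => Real.exp (β * x + d)) univ := by
  intro x _ y _ h
  have := Real.exp_injective h
  have : β * x = β * y := by linarith
  exact mul_left_cancel₀ hβ.ne' this

lemma deriv_affexp (β d : ℝ) (x : ℝ) :
    HasDerivWithinAt (fun x : ℝ => Real.exp (β * x + d)) (β * Real.exp (β * x + d)) univ x := by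
  have h : HasDerivAt (fun x : ℝ => β * x + d) β x := by
    simpa using ((hasDerivAt_id x).const_mul β).add_const d
  have := h.exp
  rw [mul_comm] at this
  exact this.hasDerivWithinAt

lemma cov_int (β d : ℝ) (hβ : 0 < β) (F : ℝ → ℂ) :
    ∫ l in Ioi 0, F l = ∫ x : ℝ, (β * Real.exp (β * x + d)) • F (Real.exp (β * x + d)) := by
  rw [← range_affexp β d hβ, integral_image_eq_integral_abs_deriv_smul MeasurableSet.univ
    (fun x _ => deriv_affexp β d x) (inj_affexp β d hβ), setIntegral_univ]
  congr 1; ext x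
  rw [abs_of_pos (by positivity)]

lemma cov_integrable {V : Type*} [NormedAddCommGroup V] [NormedSpace ℝ V]
    (β d : ℝ) (hβ : 0 < β) (F : ℝ → V) :
    IntegrableOn F (Ioi 0) ↔
      Integrable (fun x : ℝ => (β * Real.exp (β * x + d)) • F (Real.exp (β * x + d))) := by
  rw [← range_affexp β d hβ, integrableOn_image_iff_integrableOn_abs_deriv_smul MeasurableSet.univ
    (fun x _ => deriv_affexp β d x) (inj_affexp β d hβ), integrableOn_univ]
  have : ∀ x : ℝ, |β * Real.exp (β * x + d)| = β * Real.exp (β * x + d) :=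
    fun x => abs_of_pos (by positivity)
  simp only [this]

lemma major_integrable (k c : ℝ) (hk : 0 < k) (hc : 0 < c) :
    Integrable (fun x : ℝ => Real.exp (k * x) * Real.exp (c - c * Real.exp x)) := by
  have h := integrableOn_rpow_mul_exp_neg_mul_rpow (p := 1) (s := k - 1) (b := c) (by linarith)
    (by norm_num) hc
  rw [cov_integrable 1 0 one_pos] at h
  refine (h.const_mul (Real.exp c)).congr (Filter.Eventually.of_forall fun x => ?_)
  simp only [one_mul, add_zero, smul_eq_mul, Real.rpow_one]
  rw [← Real.exp_mul, ← Real.exp_add, ← Real.exp_add, ← Real.exp_add, ← Real.exp_add]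
  ring_nf

lemma stE_diff (α u t : ℝ) : Differentiable ℂ (stE α u t) := by
  unfold stE; fun_prop

lemma line_integrable (α γ u t : ℝ) (hγ1 : 1 / 2 ≤ γ) (hγ2 : γ < 1) (hα : α = 1 / γ)
    (hu : 0 < u) (ht : 0 < t) (k : ℝ) (hk : 0 < k) (φ : ℝ) (hφ : φ ∈ Icc (π * γ / 2) (π / 2)) :
    Integrable (fun x : ℝ => Complex.exp ((k : ℂ) * ((x : ℂ) + (φ : ℂ) * Complex.I)) *
      stE α u t ((x : ℂ) + (φ : ℂ) * Complex.I)) := by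
  obtain ⟨c, hc, hb⟩ := stE_bound α γ u t hγ1 hγ2 hα hu ht
  refine (major_integrable k c hk hc).mono' ?_ (Filter.Eventually.of_forall fun x => ?_)
  · apply Continuous.aestronglyMeasurable
    have := (stE_diff α u t).continuous
    fun_prop
  · rw [norm_mul, exp_line_norm]
    exact mul_le_mul_of_nonneg_left (hb φ hφ x) (Real.exp_pos _).le

lemma tendsto_major_top (c : ℝ) (hc : 0 < c) :
    Filter.Tendsto (fun x : ℝ => Real.exp x * Real.exp (c - c * Real.exp x)) Filter.atTop
      (nhds 0) := by
  have h := (tendsto_rpow_mul_exp_neg_mul_atTop_nhds_zero 1 c hc).comp Real.tendsto_exp_atTop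
  have h2 := h.const_mul (Real.exp c)
  rw [mul_zero] at h2
  refine h2.congr fun x => ?_
  simp only [Function.comp, Real.rpow_one]
  rw [← Real.exp_add, ← Real.exp_add, ← Real.exp_add]
  ring_nf

lemma tendsto_major_bot (c : ℝ) :
    Filter.Tendsto (fun x : ℝ => Real.exp x * Real.exp (c - c * Real.exp x)) Filter.atBot
      (nhds 0) := by
  have h : Filter.Tendsto (fun y : ℝ => y * Real.exp (c - c * y)) (nhds 0) (nhds 0) := by
    have : Continuous (fun y : ℝ => y * Real.exp (c - c * y)) := by fun_prop
    simpa using this.tendsto 0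
  exact h.comp Real.tendsto_exp_atBot

lemma rotate (α γ u t : ℝ) (hγ1 : 1 / 2 ≤ γ) (hγ2 : γ < 1) (hα : α = 1 / γ)
    (hu : 0 < u) (ht : 0 < t) :
    ∫ x : ℝ, Complex.exp ((x : ℂ) + ((π * γ / 2 : ℝ) : ℂ) * Complex.I) *
        stE α u t ((x : ℂ) + ((π * γ / 2 : ℝ) : ℂ) * Complex.I) =
      ∫ x : ℝ, Complex.exp ((x : ℂ) + ((π / 2 : ℝ) : ℂ) * Complex.I) *
        stE α u t ((x : ℂ) + ((π / 2 : ℝ) : ℂ) * Complex.I) := by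
  obtain ⟨c, hc, hb⟩ := stE_bound α γ u t hγ1 hγ2 hα hu ht
  have hle : π * γ / 2 ≤ π / 2 := by nlinarith [Real.pi_pos]
  have hI : ∀ φ ∈ Icc (π * γ / 2) (π / 2), Integrable (fun x : ℝ =>
      Complex.exp ((x : ℂ) + (φ : ℂ) * Complex.I) *
        stE α u t ((x : ℂ) + (φ : ℂ) * Complex.I)) := by
    intro φ hφ
    simpa using line_integrable α γ u t hγ1 hγ2 hα hu ht 1 one_pos φ hφ
  set φ₁ := π * γ / 2
  set φ₂ := π / 2
  set F : ℂ → ℂ := fun w => Complex.exp w * stE α u t w with hF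
  have hFd : Differentiable ℂ F := Complex.differentiable_exp.mul (stE_diff α u t)
  have hbd : ∀ x : ℝ, ‖∫ y : ℝ in φ₁..φ₂, F ((x : ℂ) + (y : ℂ) * Complex.I)‖ ≤
      (Real.exp x * Real.exp (c - c * Real.exp x)) * |φ₂ - φ₁| := by
    intro x
    apply intervalIntegral.norm_integral_le_of_norm_le_const
    intro y hy
    rw [uIoc_of_le hle] at hy
    rw [hF]
    simp only
    rw [norm_mul]
    have := exp_line_norm 1 x y
    simp only [Complex.ofReal_one, one_mul] at this
    rw [this]
    exact mul_le_mul_of_nonneg_left (hb y ⟨hy.1.le, hy.2⟩ x) (Real.exp_pos _).le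
  have hv : ∀ l : Filter ℝ, Filter.Tendsto
      (fun x : ℝ => Real.exp x * Real.exp (c - c * Real.exp x)) l (nhds 0) →
      Filter.Tendsto (fun x : ℝ => ∫ y : ℝ in φ₁..φ₂, F ((x : ℂ) + (y : ℂ) * Complex.I)) l
        (nhds 0) := by
    intro l hl
    refine squeeze_zero_norm hbd ?_
    simpa using hl.mul_const |φ₂ - φ₁|
  have hv1 := hv _ (tendsto_major_top c hc)
  have hv2 := (hv _ (tendsto_major_bot c)).comp Filter.tendsto_neg_atTop_atBot
  have hh1 := intervalIntegral_tendsto_integral (hI φ₁ ⟨le_rfl, hle⟩)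
    Filter.tendsto_neg_atTop_atBot Filter.tendsto_id
  have hh2 := intervalIntegral_tendsto_integral (hI φ₂ ⟨hle, le_rfl⟩)
    Filter.tendsto_neg_atTop_atBot Filter.tendsto_id
  have hlim := ((hh1.sub hh2).add (hv1.const_smul Complex.I)).sub (hv2.const_smul Complex.I)
  have hz : ∀ R : ℝ, (∫ x : ℝ in (-R)..R, F ((x : ℂ) + (φ₁ : ℂ) * Complex.I)) -
      (∫ x : ℝ in (-R)..R, F ((x : ℂ) + (φ₂ : ℂ) * Complex.I)) +
      Complex.I • (∫ y : ℝ in φ₁..φ₂, F ((R : ℂ) + (y : ℂ) * Complex.I)) -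
      Complex.I • (∫ y : ℝ in φ₁..φ₂, F (((-R : ℝ) : ℂ) + (y : ℂ) * Complex.I)) = 0 := by
    intro R
    have := Complex.integral_boundary_rect_eq_zero_of_differentiableOn F
      (⟨-R, φ₁⟩ : ℂ) (⟨R, φ₂⟩ : ℂ) hFd.differentiableOn
    simpa using this
  have h0 := tendsto_nhds_unique hlim
    (tendsto_const_nhds.congr (fun R => (hz R).symm))
  simp only [smul_zero, add_zero, sub_zero] at h0
  exact sub_eq_zero.1 h0

lemma stE_parts (α γ u t : ℝ) (hγ1 : 1 / 2 ≤ γ) (hγ2 : γ < 1) (hα : α = 1 / γ)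
    (hu : 0 < u) (ht : 0 < t) (φ : ℝ) (hφ : φ ∈ Icc (π * γ / 2) (π / 2)) :
    (α * t : ℂ) * (∫ x : ℝ, Complex.exp ((α : ℂ) * ((x : ℂ) + (φ : ℂ) * Complex.I)) *
        stE α u t ((x : ℂ) + (φ : ℂ) * Complex.I)) -
      (u : ℂ) * (∫ x : ℝ, Complex.exp ((x : ℂ) + (φ : ℂ) * Complex.I) *
        stE α u t ((x : ℂ) + (φ : ℂ) * Complex.I)) = -1 := by
  have hγ0 : 0 < γ := by linarith
  have hα0 : 0 < α := by rw [hα]; positivity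
  obtain ⟨c, hc, hb⟩ := stE_bound α γ u t hγ1 hγ2 hα hu ht
  have i1 := line_integrable α γ u t hγ1 hγ2 hα hu ht α hα0 φ hφ
  have i2 := line_integrable α γ u t hγ1 hγ2 hα hu ht 1 one_pos φ hφ
  simp only [Complex.ofReal_one, one_mul] at i2
  have j1 := i1.const_mul (α * t : ℂ)
  have j2 := i2.const_mul (u : ℂ)
  rw [← integral_const_mul, ← integral_const_mul, ← integral_sub j1 j2]
  have hline : ∀ x : ℝ, HasDerivAt (fun x : ℝ => (x : ℂ) + (φ : ℂ) * Complex.I) 1 x :=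
    fun x => (Complex.ofRealCLM.hasDerivAt (x := x)).add_const _
  have hd : ∀ w : ℂ, HasDerivAt (stE α u t)
      (stE α u t w * (-(u : ℂ) * Complex.exp w + t * (Complex.exp (α * w) * α))) w := by
    intro w
    have h1 : HasDerivAt (fun w : ℂ => (α : ℂ) * w) α w := by
      simpa using (hasDerivAt_id w).const_mul (α : ℂ)
    exact (((Complex.hasDerivAt_exp w).const_mul (-(u : ℂ))).add
      (h1.cexp.const_mul (t : ℂ))).cexp
  have hnorm : Filter.Tendsto (fun x : ℝ => stE α u t ((x : ℂ) + (φ : ℂ) * Complex.I))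
      Filter.atTop (nhds 0) := by
    refine squeeze_zero_norm (hb φ hφ) ?_
    apply Real.tendsto_exp_atBot.comp
    apply Filter.tendsto_atBot_add_const_left
    exact (Filter.tendsto_neg_atTop_atBot).comp (Real.tendsto_exp_atTop.const_mul_atTop hc)
  have hz : ∀ k : ℝ, 0 < k → Filter.Tendsto
      (fun x : ℝ => Complex.exp ((k : ℂ) * ((x : ℂ) + (φ : ℂ) * Complex.I)))
      Filter.atBot (nhds 0) := by
    intro k hk
    rw [tendsto_zero_iff_norm_tendsto_zero]
    simp only [exp_line_norm]
    exact Real.tendsto_exp_atBot.comp (Filter.tendsto_id.const_mul_atBot hk)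
  have hbot : Filter.Tendsto (fun x : ℝ => stE α u t ((x : ℂ) + (φ : ℂ) * Complex.I))
      Filter.atBot (nhds 1) := by
    have h1 := hz 1 one_pos
    simp only [Complex.ofReal_one, one_mul] at h1
    have h2 := ((h1.const_mul (-(u : ℂ))).add ((hz α hα0).const_mul (t : ℂ))).cexp
    simpa [stE] using h2
  have := integral_of_hasDerivAt_of_tendsto
    (f := fun x : ℝ => stE α u t ((x : ℂ) + (φ : ℂ) * Complex.I))
    (f' := fun x : ℝ => (α * t : ℂ) *
      (Complex.exp ((α : ℂ) * ((x : ℂ) + (φ : ℂ) * Complex.I)) *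
        stE α u t ((x : ℂ) + (φ : ℂ) * Complex.I)) -
      (u : ℂ) * (Complex.exp ((x : ℂ) + (φ : ℂ) * Complex.I) *
        stE α u t ((x : ℂ) + (φ : ℂ) * Complex.I)))
    (m := 1) (n := 0) ?_ (j1.sub j2) hbot hnorm
  · rw [this]; ring
  · intro x
    have := (hd ((x : ℂ) + (φ : ℂ) * Complex.I)).comp x (hline x)
    refine this.congr_deriv ?_
    ring

lemma zol_half (α η b x : ℝ)
    (hG : IntegrableOn (fun l : ℝ => Complex.exp (-Complex.I * (l : ℂ) * (x : ℂ)) *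
        Complex.exp (-(b : ℂ) * ((l ^ α : ℝ) : ℂ) *
          Complex.exp (-Complex.I * (π : ℂ) * (η : ℂ) / 2))) (Ioi 0)) :
    zolDensity α η b x = (1 / π) *
      (∫ l in Ioi (0 : ℝ), Complex.exp (-Complex.I * (l : ℂ) * (x : ℂ)) *
        Complex.exp (-(b : ℂ) * ((l ^ α : ℝ) : ℂ) *
          Complex.exp (-Complex.I * (π : ℂ) * (η : ℂ) / 2))).re := by
  set G : ℝ → ℂ := fun l : ℝ => Complex.exp (-Complex.I * (l : ℂ) * (x : ℂ)) *
        Complex.exp (-(b : ℂ) * ((l ^ α : ℝ) : ℂ) *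
          Complex.exp (-Complex.I * (π : ℂ) * (η : ℂ) / 2)) with hGdef
  unfold zolDensity
  set F : ℝ → ℂ := fun l : ℝ => Complex.exp (-Complex.I * (l : ℂ) * (x : ℂ)) *
        Complex.exp (-(b : ℂ) * ((|l| ^ α : ℝ) : ℂ) *
          Complex.exp (-Complex.I * (Real.pi : ℂ) * (η : ℂ) * ((Real.sign l : ℝ) : ℂ) / 2)) with hFdef
  have hFG : ∀ l ∈ Ioi (0 : ℝ), F l = G l := by
    intro l hl
    simp only [hFdef, hGdef]
    rw [Real.sign_of_pos hl, abs_of_pos hl, Complex.ofReal_one, mul_one]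
  have hneg : ∀ l, F (-l) = (starRingEnd ℂ) (F l) := by
    intro l
    simp only [hFdef]
    rw [map_mul, ← Complex.exp_conj, ← Complex.exp_conj]
    simp only [map_mul, map_neg, map_div₀, ← Complex.exp_conj, Complex.conj_ofReal, Complex.conj_I,
      Real.sign_neg, abs_neg, Complex.ofReal_neg, map_ofNat]
    congr 2
    · ring
    · congr 2
      ring
  have hFi : IntegrableOn F (Ioi 0) := hG.congr_fun (fun l hl => (hFG l hl).symm) measurableSet_Ioi
  have hFn : IntegrableOn F (Iic 0) := by
    rw [integrableOn_Iic_iff_integrableOn_Iio]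
    have hc : IntegrableOn (fun l => (starRingEnd ℂ) (F l)) (Ioi 0) :=
      (Complex.conjLIE.integrable_comp_iff (φ := F)).2 hFi
    have hc' : IntegrableOn (fun l => (starRingEnd ℂ) (F l)) (Ioi (-(0 : ℝ))) := by
      rw [neg_zero]; exact hc
    have h2 := hc'.comp_neg_Iio
    refine h2.congr_fun (fun l _ => ?_) measurableSet_Iio
    simp [hneg]
  have hFI : Integrable F := by
    rw [← integrableOn_univ, ← Iic_union_Ioi (a := (0 : ℝ))]
    exact hFn.union hFi
  have hre : (∫ l : ℝ, F l).re = ∫ l : ℝ, (F l).re := (integral_re hFI).symm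
  have hre2 : (∫ l in Ioi (0 : ℝ), G l).re = ∫ l in Ioi (0 : ℝ), (G l).re := (integral_re hG).symm
  have habs : ∀ l, (F l).re = (F |l|).re := by
    intro l
    rcases abs_choice l with h | h
    · rw [h]
    · rw [h, hneg, Complex.conj_re]
  rw [hre, hre2, integral_congr_ae (Filter.Eventually.of_forall habs),
    integral_comp_abs (f := fun l => (F l).re),
    setIntegral_congr_fun measurableSet_Ioi (fun l hl => congrArg Complex.re (hFG l hl))]
  have := Real.pi_pos
  field_simp

lemma exp_pi_half (x : ℝ) :
    Complex.exp ((x : ℂ) + ((π / 2 : ℝ) : ℂ) * Complex.I) = Complex.I * (Real.exp x : ℂ) := by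
  rw [Complex.exp_add]
  push_cast
  rw [Complex.exp_pi_div_two_mul_I, mul_comm]

lemma dual1 (α γ u t : ℝ) (hγ1 : 1 / 2 ≤ γ) (hγ2 : γ < 1) (hα : α = 1 / γ)
    (hu : 0 < u) (ht : 0 < t) :
    zolDensity α (α * (2 * γ - 1)) t u = (1 / π) *
      (∫ x : ℝ, Complex.exp ((x : ℂ) + ((π / 2 : ℝ) : ℂ) * Complex.I) *
        stE α u t ((x : ℂ) + ((π / 2 : ℝ) : ℂ) * Complex.I)).im := by
  have hγ0 : 0 < γ := by linarith
  have hαγ : α * γ = 1 := by rw [hα]; field_simp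
  have hle : π * γ / 2 ≤ π / 2 := by nlinarith [Real.pi_pos]
  have hη : α * (2 * γ - 1) = 2 - α := by linear_combination 2 * hαγ
  rw [hη]
  have key : ∀ x : ℝ, ((1 : ℝ) * Real.exp (1 * x + 0)) •
      (Complex.exp (-Complex.I * ((Real.exp (1 * x + 0) : ℝ) : ℂ) * (u : ℂ)) *
        Complex.exp (-(t : ℂ) * (((Real.exp (1 * x + 0)) ^ α : ℝ) : ℂ) *
          Complex.exp (-Complex.I * (π : ℂ) * ((2 - α : ℝ) : ℂ) / 2))) =
      -Complex.I * (Complex.exp ((x : ℂ) + ((π / 2 : ℝ) : ℂ) * Complex.I) *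
        stE α u t ((x : ℂ) + ((π / 2 : ℝ) : ℂ) * Complex.I)) := by
    intro x
    have e1 : Complex.exp ((α : ℂ) * ((x : ℂ) + ((π / 2 : ℝ) : ℂ) * Complex.I)) =
        -(((Real.exp x) ^ α : ℝ) : ℂ) *
          Complex.exp (-Complex.I * (π : ℂ) * ((2 - α : ℝ) : ℂ) / 2) := by
      rw [← Real.exp_mul, Complex.ofReal_exp, neg_mul, ← Complex.exp_add]
      rw [← mul_neg_one, ← Complex.exp_pi_mul_I, ← Complex.exp_add]
      congr 1
      push_cast
      ring
    unfold stE
    rw [e1, exp_pi_half]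
    simp only [one_mul, add_zero, Complex.real_smul]
    rw [← Complex.exp_add]
    have : -Complex.I * (Real.exp x : ℂ) * (u : ℂ) + -(t : ℂ) * (((Real.exp x) ^ α : ℝ) : ℂ) *
          Complex.exp (-Complex.I * (π : ℂ) * ((2 - α : ℝ) : ℂ) / 2) =
        -(u : ℂ) * (Complex.I * (Real.exp x : ℂ)) + (t : ℂ) * (-(((Real.exp x) ^ α : ℝ) : ℂ) *
          Complex.exp (-Complex.I * (π : ℂ) * ((2 - α : ℝ) : ℂ) / 2)) := by ring
    rw [this]
    linear_combination (-(Real.exp x : ℂ) * Complex.exp (-(u : ℂ) * (Complex.I * (Real.exp x : ℂ))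
      + (t : ℂ) * (-(((Real.exp x) ^ α : ℝ) : ℂ) *
          Complex.exp (-Complex.I * (π : ℂ) * ((2 - α : ℝ) : ℂ) / 2)))) * (-Complex.I_mul_I)
  have hint := line_integrable α γ u t hγ1 hγ2 hα hu ht 1 one_pos (π / 2) ⟨hle, le_rfl⟩
  simp only [Complex.ofReal_one, one_mul] at hint
  rw [zol_half]
  · rw [cov_int 1 0 one_pos, integral_congr_ae (Filter.Eventually.of_forall key),
      integral_const_mul]
    simp
  · rw [cov_integrable 1 0 one_pos]
    exact (hint.const_mul (-Complex.I)).congr (Filter.Eventually.of_forall fun x => (key x).symm)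

lemma dual2 (α γ u t : ℝ) (hγ1 : 1 / 2 ≤ γ) (hγ2 : γ < 1) (hα : α = 1 / γ)
    (hu : 0 < u) (ht : 0 < t) :
    zolDensity γ γ 1 (t * u ^ (-α)) = (1 / π) * (α * u ^ α *
      (∫ x : ℝ, Complex.exp ((α : ℂ) * ((x : ℂ) + ((π * γ / 2 : ℝ) : ℂ) * Complex.I)) *
        stE α u t ((x : ℂ) + ((π * γ / 2 : ℝ) : ℂ) * Complex.I)).im) := by
  have hγ0 : 0 < γ := by linarith
  have hα0 : 0 < α := by rw [hα]; positivity
  have hαγ : α * γ = 1 := by rw [hα]; field_simp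
  have hαγ' : (α : ℂ) * (γ : ℂ) = 1 := by exact_mod_cast hαγ
  have hle : π * γ / 2 ≤ π / 2 := by nlinarith [Real.pi_pos]
  have key : ∀ x : ℝ, (α * Real.exp (α * x + α * Real.log u)) •
      (Complex.exp (-Complex.I * ((Real.exp (α * x + α * Real.log u) : ℝ) : ℂ) *
          ((t * u ^ (-α) : ℝ) : ℂ)) *
        Complex.exp (-((1 : ℝ) : ℂ) * (((Real.exp (α * x + α * Real.log u)) ^ γ : ℝ) : ℂ) *
          Complex.exp (-Complex.I * (π : ℂ) * (γ : ℂ) / 2))) =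
      (starRingEnd ℂ) (-Complex.I * ((α * u ^ α : ℝ) : ℂ) *
        (Complex.exp ((α : ℂ) * ((x : ℂ) + ((π * γ / 2 : ℝ) : ℂ) * Complex.I)) *
        stE α u t ((x : ℂ) + ((π * γ / 2 : ℝ) : ℂ) * Complex.I))) := by
    intro x
    have e0 : Real.exp (α * x + α * Real.log u) = Real.exp (α * x) * u ^ α := by
      rw [Real.exp_add, Real.rpow_def_of_pos hu, mul_comm α (Real.log u)]
    have e1 : Real.exp (α * x + α * Real.log u) * (t * u ^ (-α)) = t * Real.exp (α * x) := by
      rw [e0, Real.rpow_neg hu.le]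
      have : u ^ α ≠ 0 := (Real.rpow_pos_of_pos hu _).ne'
      field_simp
    have e2 : (Real.exp (α * x + α * Real.log u)) ^ γ = u * Real.exp x := by
      rw [← Real.exp_mul]
      have : (α * x + α * Real.log u) * γ = Real.log u + x := by
        linear_combination (x + Real.log u) * hαγ
      rw [this, Real.exp_add, Real.exp_log hu]
    have e3 : Complex.exp ((α : ℂ) * ((x : ℂ) + ((π * γ / 2 : ℝ) : ℂ) * Complex.I)) =
        Complex.I * (Real.exp (α * x) : ℂ) := by
      rw [← exp_pi_half]
      congr 1
      push_cast
      linear_combination (π / 2 * Complex.I) * hαγ'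
    have e4 : (starRingEnd ℂ) (Complex.exp ((x : ℂ) + ((π * γ / 2 : ℝ) : ℂ) * Complex.I)) =
        (Real.exp x : ℂ) * Complex.exp (-Complex.I * (π : ℂ) * (γ : ℂ) / 2) := by
      rw [← Complex.exp_conj, Complex.ofReal_exp, ← Complex.exp_add]
      congr 1
      simp only [map_add, map_mul, Complex.conj_ofReal, Complex.conj_I]
      push_cast
      ring
    have e5 : (starRingEnd ℂ) (stE α u t ((x : ℂ) + ((π * γ / 2 : ℝ) : ℂ) * Complex.I)) =
        Complex.exp (-Complex.I * ((Real.exp (α * x + α * Real.log u) : ℝ) : ℂ) *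
          ((t * u ^ (-α) : ℝ) : ℂ)) *
        Complex.exp (-((1 : ℝ) : ℂ) * (((Real.exp (α * x + α * Real.log u)) ^ γ : ℝ) : ℂ) *
          Complex.exp (-Complex.I * (π : ℂ) * (γ : ℂ) / 2)) := by
      rw [mul_assoc (-Complex.I), ← Complex.ofReal_mul, e1, e2, stE, e3, ← Complex.exp_conj,
        ← Complex.exp_add]
      congr 1
      simp only [map_add, map_mul, map_neg, Complex.conj_ofReal, Complex.conj_I, e4]
      push_cast
      ring
    rw [map_mul, map_mul (starRingEnd ℂ) (Complex.exp _), e5, e3, Complex.real_smul]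
    simp only [map_mul, map_neg, Complex.conj_ofReal, Complex.conj_I]
    have e6 : ((α * Real.exp (α * x + α * Real.log u) : ℝ) : ℂ) =
        - -Complex.I * ((α * u ^ α : ℝ) : ℂ) * (-Complex.I * (Real.exp (α * x) : ℂ)) := by
      rw [e0]
      push_cast
      linear_combination (α * Complex.exp (α * x) * ((u ^ α : ℝ) : ℂ)) * Complex.I_mul_I
    rw [e6]
    ring
  have hint := line_integrable α γ u t hγ1 hγ2 hα hu ht α hα0 (π * γ / 2) ⟨le_rfl, hle⟩
  rw [zol_half]
  · rw [cov_int α (α * Real.log u) hα0, integral_congr_ae (Filter.Eventually.of_forall key),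
      integral_conj, integral_const_mul, Complex.conj_re, mul_assoc, neg_mul, Complex.neg_re,
      Complex.I_mul_re, Complex.im_ofReal_mul, neg_neg]
  · rw [cov_integrable α (α * Real.log u) hα0]
    refine Integrable.congr ?_ (Filter.Eventually.of_forall fun x => (key x).symm)
    exact (Complex.conjLIE.integrable_comp_iff).2
      (hint.const_mul (-Complex.I * ((α * u ^ α : ℝ) : ℂ)))

lemma duality (α γ u t : ℝ) (hγ1 : 1 / 2 ≤ γ) (hγ2 : γ < 1) (hα : α = 1 / γ)
    (hu : 0 < u) (ht : 0 < t) :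
    t * u ^ (-1 - α) * zolDensity γ γ 1 (t * u ^ (-α)) =
      zolDensity α (α * (2 * γ - 1)) t u := by
  have hle : π * γ / 2 ≤ π / 2 := by nlinarith [Real.pi_pos]
  rw [dual1 α γ u t hγ1 hγ2 hα hu ht, dual2 α γ u t hγ1 hγ2 hα hu ht,
    ← rotate α γ u t hγ1 hγ2 hα hu ht]
  have hp := congrArg Complex.im
    (stE_parts α γ u t hγ1 hγ2 hα hu ht (π * γ / 2) ⟨le_rfl, hle⟩)
  rw [← Complex.ofReal_mul, Complex.sub_im, Complex.im_ofReal_mul, Complex.im_ofReal_mul] at hp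
  simp only [Complex.neg_im, Complex.one_im, neg_zero] at hp
  have hpow : u ^ (-1 - α) * u ^ α * u = 1 := by
    rw [← Real.rpow_add hu]
    have : -1 - α + α = -1 := by ring
    rw [this, Real.rpow_neg_one, inv_mul_cancel₀ hu.ne']
  set A := (∫ x : ℝ, Complex.exp ((α : ℂ) * ((x : ℂ) + ((π * γ / 2 : ℝ) : ℂ) * Complex.I)) *
        stE α u t ((x : ℂ) + ((π * γ / 2 : ℝ) : ℂ) * Complex.I)).im
  set B := (∫ x : ℝ, Complex.exp ((x : ℂ) + ((π * γ / 2 : ℝ) : ℂ) * Complex.I) *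
        stE α u t ((x : ℂ) + ((π * γ / 2 : ℝ) : ℂ) * Complex.I)).im
  linear_combination (1 / π * u ^ (-1 - α) * u ^ α) * hp + (1 / π * B) * hpow

/-- Equality of the two subordination formulas for fractional Cauchy problems. -/
theorem subordination_formulas_equal (γ : ℝ) (hγ1 : 1 / 2 ≤ γ) (hγ2 : γ < 1)
    (α : ℝ) (hα : α = 1 / γ)
    (g : ℝ → ℝ) (hg : ∀ u, g u = zolDensity γ γ 1 u)
    (h : ℝ → ℝ → ℝ)
    (hh : ∀ u t, h u t = (t / γ) * u ^ (-1 - 1 / γ) * g (t * u ^ (-(1 / γ)))) :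
    ∀ t : ℝ, 0 < t → ∀ f : ℝ → ℝ, Measurable f →
      IntegrableOn (fun u => f u * h u t) (Set.Ioi 0) volume →
      IntegrableOn (fun u => f u * zolDensity (1 / γ) ((1 / γ) * (2 * γ - 1)) t u)
          (Set.Ioi 0) volume ∧
        ∫ u in Set.Ioi (0 : ℝ), f u * h u t =
          (1 / γ) * ∫ u in Set.Ioi (0 : ℝ),
            f u * zolDensity (1 / γ) ((1 / γ) * (2 * γ - 1)) t u := by

  intro t ht f _ hint
  have key : ∀ u ∈ Ioi (0 : ℝ), f u * h u t =
      (1 / γ) * (f u * zolDensity (1 / γ) ((1 / γ) * (2 * γ - 1)) t u) := by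
    intro u hu
    rw [hh, hg, ← duality (1 / γ) γ u t hγ1 hγ2 rfl hu ht]
    ring
  have hγ0 : γ ≠ 0 := by linarith
  refine ⟨?_, ?_⟩
  · have h1 := (hint.congr_fun key measurableSet_Ioi).const_mul γ
    refine h1.congr (Filter.Eventually.of_forall fun u => ?_)
    simp only
    field_simp
  · rw [setIntegral_congr_fun measurableSet_Ioi key, integral_const_mul]
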